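/- Small boundary controls dyadic boundary sums: There is a constant C = C(d) such that the following holds. Let σ be a Radon measure on ℝ^d, t > 0, and let R be a cube with t-small boundary with respect to σ. Then for every integer k ≥ 0, Σ_{P ∈ 𝒟_k(R), 5P ∩ ∂R ≠ ∅} σ(5P) ≤ C t 2^{−k} σ(5R), where 𝒟_k(R) is the partition of R into 2^{kd} congruent subcubes of side length 2^{−k} ℓ(R). -/

import Mathlib

open MeasureTheory Metric Set ENNReal

noncomputable section

abbrev Pt (d : ℕ) := EuclideanSpace ℝ (Fin d)

structure Cube (d : ℕ) where
  center : Pt d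
  side : ℝ

def Cube.toSet {d : ℕ} (Q : Cube d) : Set (Pt d) :=
  {x | ∀ i, |x i - Q.center i| ≤ Q.side / 2}

def Cube.scale {d : ℕ} (a : ℝ) (Q : Cube d) : Cube d := ⟨Q.center, a * Q.side⟩

def HasDegree {d : ℕ} (μ : Measure (Pt d)) (n C₀ : ℝ) : Prop :=
  ∀ (x : Pt d) (r : ℝ), 0 < r → μ (ball x r) ≤ ENNReal.ofReal (C₀ * r ^ n)

structure IsCZKernel {d : ℕ} (K : Pt d → Pt d → ℂ) (n C α : ℝ) : Prop where
  size : ∀ x y : Pt d, x ≠ y → ‖K x y‖ ≤ C / dist x y ^ n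
  smooth_fst : ∀ x x' y : Pt d, x ≠ y → 2 * dist x x' ≤ dist x y →
    ‖K x y - K x' y‖ ≤ C * dist x x' ^ α / dist x y ^ (n + α)
  smooth_snd : ∀ x y y' : Pt d, x ≠ y → 2 * dist y y' ≤ dist x y →
    ‖K x y - K x y'‖ ≤ C * dist y y' ^ α / dist x y ^ (n + α)

def truncT {d : ℕ} (μ : Measure (Pt d)) (K : Pt d → Pt d → ℂ) (ε : ℝ) (f : Pt d → ℂ)
    (x : Pt d) : ℂ :=
  ∫ y in {y | ε < dist x y}, K x y * f y ∂μ

def maxT {d : ℕ} (μ : Measure (Pt d)) (K : Pt d → Pt d → ℂ) (δ : ℝ) (f : Pt d → ℂ)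
    (x : Pt d) : ℝ≥0∞ :=
  ⨆ (ε : ℝ) (_ : δ < ε), (‖truncT μ K ε f x‖₊ : ℝ≥0∞)

def ballMax {d : ℕ} (μ : Measure (Pt d)) (f : Pt d → ℂ) (x : Pt d) : ℝ≥0∞ :=
  ⨆ (r : ℝ) (_ : 0 < r), (∫⁻ y in ball x r, ‖f y‖₊ ∂μ) / μ (ball x r)

def cubeMax {d : ℕ} (μ : Measure (Pt d)) (p : ℝ) (f : Pt d → ℂ) (x : Pt d) : ℝ≥0∞ :=
  ⨆ (r : ℝ) (_ : 0 < r),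
    ((∫⁻ y in (Cube.toSet ⟨x, 2 * r⟩), (‖f y‖₊ : ℝ≥0∞) ^ p ∂μ) / μ (Cube.toSet ⟨x, 2 * r⟩)) ^ (1 / p)

def IsAdmissible {d : ℕ} (μ : Measure (Pt d)) (Q : Cube d) (p B₁ : ℝ) (b : Pt d → ℂ) : Prop :=
  (∀ x ∉ Q.toSet, b x = 0) ∧
  (∫ x in Q.toSet, b x ∂μ = ((μ Q.toSet).toReal : ℂ)) ∧
  (∫⁻ x in Q.toSet, (‖b x‖₊ : ℝ≥0∞) ^ p ∂μ ≤ ENNReal.ofReal B₁ * μ Q.toSet)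

def IsDoubling {d : ℕ} (μ : Measure (Pt d)) (a b : ℝ) (Q : Cube d) : Prop :=
  μ (Cube.scale a Q).toSet ≤ ENNReal.ofReal b * μ Q.toSet

def SmallBoundary {d : ℕ} (μ : Measure (Pt d)) (t : ℝ) (Q : Cube d) : Prop :=
  ∀ lam : ℝ, 0 < lam →
    μ {x ∈ (Cube.scale 5 Q).toSet | infDist x (frontier Q.toSet) ≤ lam * Q.side}
      ≤ ENNReal.ofReal (t * lam) * μ (Cube.scale 5 Q).toSet

def Cube.dyadicPiece {d : ℕ} (R : Cube d) (j : ℕ) (m : Fin d → Fin (2 ^ j)) : Cube d :=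
  ⟨(WithLp.equiv 2 (Fin d → ℝ)).symm
      (fun i => R.center i - R.side / 2 + R.side / 2 ^ j * ((m i : ℝ) + 1 / 2)),
    R.side / 2 ^ j⟩

theorem aux_dist {d : ℕ} (x y : Pt d) (a : ℝ) (ha : 0 ≤ a) (h : ∀ i, |x i - y i| ≤ a) :
    dist x y ≤ (d + 1) * a := by
  rw [EuclideanSpace.dist_eq]
  apply Real.sqrt_le_iff.2
  refine ⟨by positivity, ?_⟩
  calc ∑ i, dist (x i) (y i) ^ 2 ≤ ∑ i : Fin d, a ^ 2 := by
        apply Finset.sum_le_sum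
        intro i _
        rw [Real.dist_eq]
        exact pow_le_pow_left₀ (abs_nonneg _) (h i) 2
    _ = d * a ^ 2 := by simp
    _ ≤ ((d + 1) * a) ^ 2 := by
        have : (0 : ℝ) ≤ d := by positivity
        nlinarith [mul_nonneg this (sq_nonneg a), sq_nonneg a, mul_nonneg (mul_nonneg this this) (sq_nonneg a)]

theorem aux_mem {d : ℕ} (R : Cube d) (k : ℕ) (m : Fin d → Fin (2 ^ k)) (x : Pt d) :
    x ∈ (Cube.scale 5 (R.dyadicPiece k m)).toSet ↔
      ∀ i, |x i - (R.center i - R.side / 2 + R.side / 2 ^ k * ((m i : ℝ) + 1 / 2))|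
        ≤ 5 * (R.side / 2 ^ k) / 2 := Iff.rfl

theorem aux_sub {d : ℕ} (R : Cube d) (hR : 0 < R.side) (k : ℕ) (m : Fin d → Fin (2 ^ k)) :
    (Cube.scale 5 (R.dyadicPiece k m)).toSet ⊆ (Cube.scale 5 R).toSet := by
  intro x hx i
  have h := (aux_mem R k m x).1 hx i
  change |x i - R.center i| ≤ 5 * R.side / 2
  have hm : (m i : ℝ) + 1 ≤ 2 ^ k := by exact_mod_cast (m i).isLt
  have hm0 : (0 : ℝ) ≤ (m i : ℝ) := by positivity
  have h1 : (1 : ℝ) ≤ 2 ^ k := one_le_pow₀ (by norm_num)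
  obtain ⟨s, hs⟩ : ∃ s, s = R.side / 2 ^ k := ⟨_, rfl⟩
  have hs0 : 0 < s := by rw [hs]; positivity
  have hRs : R.side = s * 2 ^ k := by rw [hs]; field_simp
  rw [← hs, hRs] at h
  rw [hRs]
  rw [abs_le] at h ⊢
  have e1 := mul_le_mul_of_nonneg_left hm hs0.le
  have e2 := mul_le_mul_of_nonneg_left h1 hs0.le
  have e3 := mul_nonneg hs0.le hm0
  constructor <;> nlinarith [h.1, h.2]

theorem aux_closed {d : ℕ} (Q : Cube d) : IsClosed Q.toSet := by
  unfold Cube.toSet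
  rw [ofPred_forall]
  apply isClosed_iInter
  intro i
  exact isClosed_le (by fun_prop) continuous_const

theorem aux_inj {d : ℕ} (R : Cube d) (hR : 0 < R.side) (k : ℕ) (m m' : Fin d → Fin (2 ^ k))
    (x : Pt d) (hx : x ∈ (Cube.scale 5 (R.dyadicPiece k m)).toSet)
    (hx' : x ∈ (Cube.scale 5 (R.dyadicPiece k m')).toSet)
    (h : ∀ i, (m i : ℕ) % 6 = (m' i : ℕ) % 6) : m = m' := by
  funext i
  have h1 := (aux_mem R k m x).1 hx i
  have h2 := (aux_mem R k m' x).1 hx' i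
  have h3 := h i
  have hs0 : 0 < R.side / 2 ^ k := by positivity
  generalize R.side / 2 ^ k = s at *
  rw [abs_le] at h1 h2
  have a1 : ((m i : ℕ) : ℝ) ≤ (m' i : ℕ) + 5 := by
    apply le_of_mul_le_mul_left _ hs0
    nlinarith [h1.1, h1.2, h2.1, h2.2]
  have a2 : ((m' i : ℕ) : ℝ) ≤ (m i : ℕ) + 5 := by
    apply le_of_mul_le_mul_left _ hs0
    nlinarith [h1.1, h1.2, h2.1, h2.2]
  have b1 : (m i : ℕ) ≤ (m' i : ℕ) + 5 := by exact_mod_cast a1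
  have b2 : (m' i : ℕ) ≤ (m i : ℕ) + 5 := by exact_mod_cast a2
  apply Fin.ext
  omega

open Classical in
/-- **Small boundary controls dyadic boundary sums.**
There is `C = C(d)` such that for any Radon measure `σ`, `t > 0` and any cube `R` with
`t`-small boundary with respect to `σ`, for every `k ≥ 0`:
`Σ_{P ∈ 𝒟_k(R), 5P ∩ ∂R ≠ ∅} σ(5P) ≤ C t 2^{−k} σ(5R)`, where `𝒟_k(R)` is the partition of
`R` into `2^{kd}` congruent subcubes of side length `2^{−k} ℓ(R)`. -/
theorem small_boundary_dyadic_sum (d : ℕ) :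
    ∃ Cc : ℝ, 0 < Cc ∧
      ∀ σ : Measure (Pt d), IsLocallyFiniteMeasure σ →
      ∀ t : ℝ, 0 < t →
      ∀ R : Cube d, 0 < R.side → SmallBoundary σ t R →
      ∀ k : ℕ,
        (∑ m : Fin d → Fin (2 ^ k),
          if ((Cube.scale 5 (R.dyadicPiece k m)).toSet ∩ frontier R.toSet).Nonempty then
            σ (Cube.scale 5 (R.dyadicPiece k m)).toSet
          else 0)
          ≤ ENNReal.ofReal (Cc * t * 2 ^ (-(k : ℝ))) * σ (Cube.scale 5 R).toSet := by
  refine ⟨6 ^ d * (5 * (d + 1)), by positivity, ?_⟩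
  intro σ _ t ht R hR hSB k
  have hs0 : 0 < R.side / 2 ^ k := by positivity
  set lam : ℝ := 5 * (d + 1) / 2 ^ k with hlam
  set A : Set (Pt d) := {x ∈ (Cube.scale 5 R).toSet |
    infDist x (frontier R.toSet) ≤ lam * R.side} with hA
  have hAm : MeasurableSet A :=
    ((aux_closed _).inter (isClosed_le (continuous_infDist_pt _) continuous_const)).measurableSet
  have hb := hSB lam (by positivity)
  set S : (Fin d → Fin (2 ^ k)) → Set (Pt d) :=
    fun m => (Cube.scale 5 (R.dyadicPiece k m)).toSet with hS
  have hSA : ∀ m, (S m ∩ frontier R.toSet).Nonempty → S m ⊆ A := by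
    rintro m ⟨y, hy, hyf⟩ x hx
    refine ⟨aux_sub R hR k m hx, (infDist_le_dist_of_mem hyf).trans ?_⟩
    have := aux_dist x y (5 * (R.side / 2 ^ k)) (by positivity) (by
      intro i
      have h1 := (aux_mem R k m x).1 hx i
      have h2 := (aux_mem R k m y).1 hy i
      rw [abs_le] at *
      constructor <;> linarith [h1.1, h1.2, h2.1, h2.2])
    calc dist x y ≤ _ := this
      _ = lam * R.side := by rw [hlam]; ring
  set F := Finset.univ.filter (fun m => (S m ∩ frontier R.toSet).Nonempty) with hF
  have key : ∑ m ∈ F, σ (S m) ≤ 6 ^ d * σ A := by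
    have e1 : ∀ m, σ (S m) = ∫⁻ x, (S m).indicator 1 x ∂σ := fun m =>
      (lintegral_indicator_one (aux_closed _).measurableSet).symm
    simp_rw [e1]
    rw [← lintegral_indicator_one hAm, ← lintegral_finsetSum,
      ← lintegral_const_mul]
    · apply lintegral_mono
      intro x
      by_cases hx : x ∈ A
      · simp only [hx, indicator_of_mem, Pi.one_apply, mul_one]
        simp only [indicator_apply, Pi.one_apply]
        rw [← Finset.sum_filter, Finset.sum_const, nsmul_eq_mul, mul_one]
        have hc : (F.filter (fun m => x ∈ S m)).card ≤
            (Finset.univ : Finset (Fin d → Fin 6)).card := by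
          apply Finset.card_le_card_of_injOn
            (fun m i => (⟨(m i : ℕ) % 6, Nat.mod_lt _ (by norm_num)⟩ : Fin 6))
          · intro m _
            simp
          · intro m hm m' hm' h
            have hm := (Finset.mem_filter.1 hm).2
            have hm' := (Finset.mem_filter.1 hm').2
            refine aux_inj R hR k m m' x hm hm' ?_
            intro i
            exact congrArg Fin.val (congrFun h i)
        simp only [Finset.card_univ, Fintype.card_pi, Fintype.card_fin, Finset.prod_const] at hc
        exact_mod_cast hc
      · beta_reduce
        rw [Finset.sum_eq_zero]
        · exact zero_le
        · intro m hm
          exact indicator_of_notMem (fun h => hx (hSA m (Finset.mem_filter.1 hm).2 h)) _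
    · exact measurable_one.indicator hAm
    · intro m _
      exact measurable_one.indicator (aux_closed _).measurableSet
  rw [← Finset.sum_filter]
  refine key.trans ?_
  calc (6 : ℝ≥0∞) ^ d * σ A ≤ 6 ^ d * (ENNReal.ofReal (t * lam) * σ (Cube.scale 5 R).toSet) := by
        gcongr
    _ = _ := by
        rw [← mul_assoc]
        congr 1
        have : (6 : ℝ≥0∞) ^ d = ENNReal.ofReal (6 ^ d) := by
          rw [ENNReal.ofReal_pow (by norm_num)]; norm_num
        rw [this, ← ENNReal.ofReal_mul (by positivity)]
        congr 1
        rw [Real.rpow_neg (by norm_num), Real.rpow_natCast, hlam]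
        ring
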